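/- arXiv:1305.2110 — 5 statements merged into one kernel-verified Lean document; each statement's English description precedes it below -/
import Mathlib

section
/- Let m ≥ 2 and let η be the Minkowski bilinear form on ℝ^m, with standard basis (e₀,…,e_{m−1}), and let v ∈ ℝ^m satisfy η(v,v) = 1. Define the matrices M, N : Fin m → Fin m → ℝ by M a b := 2·η(eₐ,v)·η(e_b,v) − η(eₐ,e_b) and N a b := 2·(v a)·(v b) − η(eₐ,e_b). Then M · N = 1 (N is the inverse matrix of M). -/
open scoped InnerProductSpace

noncomputable section

/-- The Minkowski bilinear form of signature `(+,-,...,-)` on `ℝ^m`: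
`η(u,w) = u 0 * w 0 - ∑_{i=1}^{m-1} u i * w i`. -/
def mink (m : ℕ) (u w : Fin m → ℝ) : ℝ :=
  ∑ i : Fin m, if i.val = 0 then u i * w i else -(u i * w i)

/-- The standard basis of `ℝ^m`. -/
def stdb (m : ℕ) (a : Fin m) : Fin m → ℝ := Pi.single a 1

/-- The `i`-th diagonal entry of the Minkowski form in the standard basis. -/
def minkSign {m : ℕ} (i : Fin m) : ℝ := if i.val = 0 then 1 else -1

lemma minkSign_mul_self {m : ℕ} (i : Fin m) : minkSign i * minkSign i = 1 := by
  unfold minkSign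
  split_ifs <;> norm_num

lemma mink_eq_sum (m : ℕ) (u w : Fin m → ℝ) :
    mink m u w = ∑ i, minkSign i * (u i * w i) := by
  unfold mink minkSign
  refine Finset.sum_congr rfl fun i _ => ?_
  split_ifs <;> ring

lemma mink_stdb_left (m : ℕ) (a : Fin m) (w : Fin m → ℝ) :
    mink m (stdb m a) w = minkSign a * w a := by
  simp [mink_eq_sum, stdb, Pi.single_apply]

/-- the inverse of `g⁺_{ab} = 2 v_a v_b - g_{ab}` is `g⁺^{ab} = 2 v^a v^b - g^{ab}`. -/
theorem stmt1 (m : ℕ) (hm : 2 ≤ m) (v : Fin m → ℝ) (hv : mink m v v = 1)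
    (M N : Matrix (Fin m) (Fin m) ℝ)
    (hM : ∀ a b, M a b = 2 * mink m (stdb m a) v * mink m (stdb m b) v
      - mink m (stdb m a) (stdb m b))
    (hN : ∀ a b, N a b = 2 * v a * v b - mink m (stdb m a) (stdb m b)) :
    M * N = 1 := by
  ext a c
  have hstdb (a b : Fin m) : stdb m b a = (1 : Matrix (Fin m) (Fin m) ℝ) a b := by
    simp [stdb, Pi.single_apply, Matrix.one_apply]
  have hterm (b : Fin m) : M a b * N b c =
      4 * minkSign a * v a * v c * (minkSign b * (v b * v b))
        - (if b = c then 2 * minkSign a * v a * v b else 0)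
        - (if a = b then 2 * minkSign a * v b * v c
            - (1 : Matrix (Fin m) (Fin m) ℝ) b c else 0) := by
    have hb := minkSign_mul_self b
    simp only [hM, hN, mink_stdb_left, hstdb, Matrix.one_apply]
    split_ifs with hab hbc hbc
    · subst hab
      linear_combination (1 - 2 * minkSign a * v a * v a) * hb
    · subst hab
      ring
    · linear_combination (-2 * minkSign a * v a * v b) * hb
    · ring
  rw [mink_eq_sum] at hv
  simp only [Matrix.mul_apply, hterm, Finset.sum_sub_distrib, ← Finset.mul_sum, hv,
    Finset.sum_ite_eq, Finset.sum_ite_eq', Finset.mem_univ, if_true]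
  ring
end
end

section
/- Let m ≥ 3, let η be the Minkowski bilinear form on ℝ^m, let W be a finite-dimensional real inner product space and A : ℝ^m →ₗ[ℝ] W a linear map; let f, e, T be the first fundamental form, energy density, and energy-momentum tensor built from η and A. If v ∈ ℝ^m satisfies η(v,v) = 1, then the energy density measured by v satisfies T(v,v) ≥ 0, and T(v,v) = 0 if and only if A = 0. -/
open scoped InnerProductSpace

noncomputable section

variable {W : Type*} [NormedAddCommGroup W] [InnerProductSpace ℝ W] [FiniteDimensional ℝ W]

/-- The first fundamental form `f(u,w) = ⟪A u, A w⟫` built from the differential `A = dφ`. -/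
def firstFF {m : ℕ} (A : (Fin m → ℝ) →ₗ[ℝ] W) (u w : Fin m → ℝ) : ℝ := ⟪A u, A w⟫_ℝ

/-- The energy density `e = (1/2)·(f(e₀,e₀) - ∑_{i=1}^{m-1} f(eᵢ,eᵢ))`, the η-trace of `f`. -/
def energyDens (m : ℕ) [NeZero m] (A : (Fin m → ℝ) →ₗ[ℝ] W) : ℝ :=
  (1 / 2) * (firstFF A (stdb m 0) (stdb m 0) -
    ∑ i ∈ Finset.univ.erase (0 : Fin m), firstFF A (stdb m i) (stdb m i))

/-- The energy-momentum tensor `T(u,w) = f(u,w) - e·η(u,w)`. -/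
def emTensor (m : ℕ) [NeZero m] (A : (Fin m → ℝ) →ₗ[ℝ] W) (u w : Fin m → ℝ) : ℝ :=
  firstFF A u w - energyDens m A * mink m u w

theorem norm_sum_smul_sq_le {V : Type*} [NormedAddCommGroup V] [InnerProductSpace ℝ V]
    {ι : Type*} (s : Finset ι) (t : ι → ℝ) (a : ι → V) :
    ‖∑ i ∈ s, t i • a i‖ ^ 2 ≤ (∑ i ∈ s, t i ^ 2) * ∑ i ∈ s, ‖a i‖ ^ 2 := by
  calc ‖∑ i ∈ s, t i • a i‖ ^ 2 ≤ (∑ i ∈ s, |t i| * ‖a i‖) ^ 2 := by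
        gcongr
        exact (norm_sum_le _ _).trans_eq (by simp [norm_smul])
    _ ≤ (∑ i ∈ s, |t i| ^ 2) * ∑ i ∈ s, ‖a i‖ ^ 2 := Finset.sum_mul_sq_le_sq_mul_sq _ _ _
    _ = _ := by simp

/-- Coercivity of the energy density: for `w = p • x + ∑ tᵢ • aᵢ` with `p² - ∑ tᵢ² = 1`, the form
`‖w‖² - (‖x‖² - ∑ ‖aᵢ‖²) / 2` controls `‖w‖²` and `∑ ‖aᵢ‖²`. -/
theorem energy_coercive {V : Type*} [NormedAddCommGroup V] [InnerProductSpace ℝ V]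
    {ι : Type*} (s : Finset ι) (t : ι → ℝ) (a : ι → V) (p : ℝ) (x w : V)
    (hp : p ^ 2 = 1 + ∑ i ∈ s, t i ^ 2) (hw : w = p • x + ∑ i ∈ s, t i • a i) :
    ‖w‖ ^ 2 + (1 / 2) * ∑ i ∈ s, ‖a i‖ ^ 2 ≤
      2 * p ^ 2 * (‖w‖ ^ 2 - (1 / 2) * (‖x‖ ^ 2 - ∑ i ∈ s, ‖a i‖ ^ 2)) := by
  have hb := norm_sum_smul_sq_le s t a
  have hx : p ^ 2 * ‖x‖ ^ 2 = ‖w‖ ^ 2 - 2 * ⟪w, ∑ i ∈ s, t i • a i⟫_ℝ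
      + ‖∑ i ∈ s, t i • a i‖ ^ 2 := by
    rw [← norm_sub_sq_real, hw, add_sub_cancel_right, norm_smul, mul_pow, Real.norm_eq_abs, sq_abs]
  have hcross : 0 ≤ 2 * ⟪w, ∑ i ∈ s, t i • a i⟫_ℝ + 2 * (∑ i ∈ s, t i ^ 2) * ‖w‖ ^ 2
      + (1 / 2) * ∑ i ∈ s, ‖a i‖ ^ 2 := by
    simp only [inner_sum, Finset.mul_sum, Finset.sum_mul, ← Finset.sum_add_distrib]
    refine Finset.sum_nonneg fun i _ => ?_
    have h := sq_nonneg ‖(2 * t i) • w + a i‖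
    rw [norm_add_sq_real, norm_smul, mul_pow, Real.norm_eq_abs, sq_abs, real_inner_smul_left] at h
    rw [real_inner_smul_right]
    linarith
  rw [hp] at hx ⊢
  linarith

theorem mink_self (m : ℕ) [NeZero m] (v : Fin m → ℝ) :
    mink m v v = v 0 ^ 2 - ∑ i ∈ Finset.univ.erase (0 : Fin m), v i ^ 2 := by
  rw [mink, ← Finset.add_sum_erase _ _ (Finset.mem_univ (0 : Fin m)), sub_eq_add_neg,
    ← Finset.sum_neg_distrib]
  congr 1
  · simp [sq]
  · refine Finset.sum_congr rfl fun i hi => ?_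
    rw [if_neg (Fin.val_ne_zero_iff.2 (Finset.ne_of_mem_erase hi)), sq]

theorem map_eq_sum_stdb {V : Type*} [NormedAddCommGroup V] [InnerProductSpace ℝ V]
    (m : ℕ) [NeZero m] (A : (Fin m → ℝ) →ₗ[ℝ] V) (v : Fin m → ℝ) :
    A v = v 0 • A (stdb m 0) + ∑ i ∈ Finset.univ.erase (0 : Fin m), v i • A (stdb m i) := by
  rw [Finset.add_sum_erase _ (fun i => v i • A (stdb m i)) (Finset.mem_univ (0 : Fin m))]
  conv_lhs => rw [pi_eq_sum_univ' v]
  simp only [map_sum, map_smul, stdb]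

/-- the energy density `T(v,v)` measured by a unit timelike observer is
nonnegative, and vanishes iff `A = dφ` vanishes. -/
theorem stmt2 (m : ℕ) [NeZero m] (hm : 3 ≤ m)
    (A : (Fin m → ℝ) →ₗ[ℝ] W) (v : Fin m → ℝ) (hv : mink m v v = 1) :
    0 ≤ emTensor m A v v ∧ (emTensor m A v v = 0 ↔ A = 0) := by
  have hp : v 0 ^ 2 = 1 + ∑ i ∈ Finset.univ.erase (0 : Fin m), v i ^ 2 := by
    linarith [mink_self m v]
  have hp0 : 0 < v 0 ^ 2 := by
    rw [hp]
    positivity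
  have key := energy_coercive _ v (fun i => A (stdb m i)) (v 0) _ _ hp (map_eq_sum_stdb m A v)
  have hT : emTensor m A v v = ‖A v‖ ^ 2 - (1 / 2) * (‖A (stdb m 0)‖ ^ 2 -
      ∑ i ∈ Finset.univ.erase (0 : Fin m), ‖A (stdb m i)‖ ^ 2) := by
    simp only [emTensor, energyDens, firstFF, hv, mul_one, real_inner_self_eq_norm_sq]
  rw [← hT] at key
  have hS : 0 ≤ ∑ i ∈ Finset.univ.erase (0 : Fin m), ‖A (stdb m i)‖ ^ 2 := by positivity
  have hw := sq_nonneg ‖A v‖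
  refine ⟨nonneg_of_mul_nonneg_right (le_trans (by positivity) key) (by positivity),
    fun h => ?_, fun h => by rw [hT, h]; simp⟩
  rw [h, mul_zero] at key
  have hS0 : ∑ i ∈ Finset.univ.erase (0 : Fin m), ‖A (stdb m i)‖ ^ 2 = 0 := by linarith
  have ha : ∀ i ∈ Finset.univ.erase (0 : Fin m), A (stdb m i) = 0 := fun i hi => by
    simpa using (Finset.sum_eq_zero_iff_of_nonneg fun _ _ => sq_nonneg _).1 hS0 i hi
  have hx : A (stdb m 0) = 0 := by
    have hw0 : ‖A v‖ ^ 2 = 0 := by linarith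
    rw [hw0, hS0, h] at hT
    have : ‖A (stdb m 0)‖ ^ 2 = 0 := by linarith
    simpa using this
  refine LinearMap.ext fun u => ?_
  rw [map_eq_sum_stdb, hx, Finset.sum_eq_zero fun i hi => by rw [ha i hi, smul_zero]]
  simp
end
end

section
/- Let m ≥ 3, let η be the Minkowski bilinear form on ℝ^m, let W be a finite-dimensional real inner product space and A : ℝ^m →ₗ[ℝ] W a linear map; let f, e, T be the first fundamental form, energy density, and energy-momentum tensor built from η and A. Let v ∈ ℝ^m satisfy η(v,v) = 1 and define the momentum one-form I by I(u) := T(u,v) with η-norm squared |I|² := T(e₀,v)² − ∑_{i=1}^{m−1} T(eᵢ,v)². Then e² ≤ |I|² ≤ T(v,v)². -/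
open scoped InnerProductSpace

noncomputable section

variable {W : Type*} [NormedAddCommGroup W] [InnerProductSpace ℝ W] [FiniteDimensional ℝ W]

/-- If `v` is unit timelike and `∑ vᵢ bᵢ = 0`, then the `η`-trace of the Gram matrix of `b` is
nonpositive. -/
theorem norm_sq_le_sum_norm_sq_of_unit_timelike {ι E : Type*} [SeminormedAddCommGroup E]
    [NormedSpace ℝ E] (s : Finset ι) (t : ℝ) (x : ι → ℝ) (c : E) (b : ι → E)
    (hx : t ^ 2 - ∑ i ∈ s, x i ^ 2 = 1) (hb : t • c + ∑ i ∈ s, x i • b i = 0) :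
    ‖c‖ ^ 2 ≤ ∑ i ∈ s, ‖b i‖ ^ 2 := by
  have hnorm : |t| * ‖c‖ ≤ ∑ i ∈ s, |x i| * ‖b i‖ := by
    rw [← Real.norm_eq_abs, ← norm_smul, eq_neg_of_add_eq_zero_left hb, norm_neg]
    refine (norm_sum_le _ _).trans_eq (Finset.sum_congr rfl fun i _ => ?_)
    rw [norm_smul, Real.norm_eq_abs]
  have hsq : t ^ 2 * ‖c‖ ^ 2 ≤ (∑ i ∈ s, x i ^ 2) * ∑ i ∈ s, ‖b i‖ ^ 2 := by
    calc t ^ 2 * ‖c‖ ^ 2 = (|t| * ‖c‖) ^ 2 := by rw [mul_pow, sq_abs]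
      _ ≤ (∑ i ∈ s, |x i| * ‖b i‖) ^ 2 := by gcongr
      _ ≤ (∑ i ∈ s, |x i| ^ 2) * ∑ i ∈ s, ‖b i‖ ^ 2 := Finset.sum_mul_sq_le_sq_mul_sq _ _ _
      _ = _ := by simp only [sq_abs]
  have hX : 0 ≤ ∑ i ∈ s, x i ^ 2 := Finset.sum_nonneg fun i _ => sq_nonneg _
  have hB : 0 ≤ ∑ i ∈ s, ‖b i‖ ^ 2 := Finset.sum_nonneg fun i _ => sq_nonneg _
  nlinarith

theorem mink_eq (m : ℕ) [NeZero m] (u w : Fin m → ℝ) :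
    mink m u w = u 0 * w 0 - ∑ i ∈ Finset.univ.erase (0 : Fin m), u i * w i := by
  rw [mink, ← Finset.add_sum_erase _ _ (Finset.mem_univ (0 : Fin m)), sub_eq_add_neg,
    ← Finset.sum_neg_distrib]
  congr 1
  refine Finset.sum_congr rfl fun i hi => if_neg fun h => Finset.ne_of_mem_erase hi ?_
  exact Fin.ext (by simpa using h)

theorem mink_stdb_zero (m : ℕ) [NeZero m] (v : Fin m → ℝ) : mink m (stdb m 0) v = v 0 := by
  simp [mink, stdb, Pi.single_apply, Finset.sum_ite, Finset.filter_eq', Finset.filter_ne']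

theorem mink_stdb_of_ne_zero (m : ℕ) [NeZero m] (v : Fin m → ℝ) {i : Fin m} (hi : i ≠ 0) :
    mink m (stdb m i) v = -v i := by
  simp [mink_eq, stdb, Pi.single_apply, hi, hi.symm]

theorem map_eq_stdb_sum {m : ℕ} [NeZero m] {E : Type*} [AddCommGroup E] [Module ℝ E]
    (A : (Fin m → ℝ) →ₗ[ℝ] E) (v : Fin m → ℝ) :
    A v = v 0 • A (stdb m 0) + ∑ i ∈ Finset.univ.erase (0 : Fin m), v i • A (stdb m i) := by
  rw [Finset.add_sum_erase _ (fun i => v i • A (stdb m i)) (Finset.mem_univ 0)]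
  conv_lhs => rw [pi_eq_sum_univ' v]
  simp [stdb, map_sum, map_smul]

/-- estimate `e² ≤ |I|² ≤ T(v,v)²` for the momentum one-form
`I = T(·,v)` of a unit timelike observer `v`. -/
theorem stmt3 (m : ℕ) [NeZero m] (hm : 3 ≤ m)
    (A : (Fin m → ℝ) →ₗ[ℝ] W) (v : Fin m → ℝ) (hv : mink m v v = 1) :
    energyDens m A ^ 2 ≤
        emTensor m A (stdb m 0) v ^ 2 -
          ∑ i ∈ Finset.univ.erase (0 : Fin m), emTensor m A (stdb m i) v ^ 2 ∧
      emTensor m A (stdb m 0) v ^ 2 -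
          ∑ i ∈ Finset.univ.erase (0 : Fin m), emTensor m A (stdb m i) v ^ 2 ≤
        emTensor m A v v ^ 2 := by
  have hv' : v 0 ^ 2 - ∑ i ∈ Finset.univ.erase (0 : Fin m), v i ^ 2 = 1 := by
    simpa only [mink_eq, ← pow_two] using hv
  have hAv := map_eq_stdb_sum A v
  have hTi : ∀ i ∈ Finset.univ.erase (0 : Fin m), emTensor m A (stdb m i) v =
      firstFF A (stdb m i) v + energyDens m A * v i := fun i hi => by
    rw [emTensor, mink_stdb_of_ne_zero m v (Finset.ne_of_mem_erase hi)]
    ring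
  have hsum : ∑ i ∈ Finset.univ.erase (0 : Fin m), emTensor m A (stdb m i) v ^ 2 =
      ∑ i ∈ Finset.univ.erase (0 : Fin m),
        (firstFF A (stdb m i) v + energyDens m A * v i) ^ 2 :=
    Finset.sum_congr rfl fun i hi => by rw [hTi i hi]
  have hT0 : emTensor m A (stdb m 0) v = firstFF A (stdb m 0) v - energyDens m A * v 0 := by
    rw [emTensor, mink_stdb_zero]
  have hTv : emTensor m A v v = firstFF A v v - energyDens m A := by rw [emTensor, hv, mul_one]
  have hF : firstFF A v v = v 0 * firstFF A (stdb m 0) v +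
      ∑ i ∈ Finset.univ.erase (0 : Fin m), v i * firstFF A (stdb m i) v := by
    simp only [firstFF]
    conv_lhs => arg 2; rw [hAv]
    simp only [inner_add_left, sum_inner, real_inner_smul_left]
  have he : 2 * energyDens m A = firstFF A (stdb m 0) (stdb m 0) -
      ∑ i ∈ Finset.univ.erase (0 : Fin m), firstFF A (stdb m i) (stdb m i) := by
    rw [energyDens]
    ring
  rw [hsum, hT0, hTv]
  set s := Finset.univ.erase (0 : Fin m)
  set e := energyDens m A
  set F := firstFF A v v with hFdef
  have hexpand (r : ℝ) : ∑ i ∈ s, (firstFF A (stdb m i) v + r * v i) ^ 2 =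
      ∑ i ∈ s, firstFF A (stdb m i) v ^ 2 + 2 * r * ∑ i ∈ s, v i * firstFF A (stdb m i) v +
        r ^ 2 * ∑ i ∈ s, v i ^ 2 := by
    rw [Finset.mul_sum, Finset.mul_sum, ← Finset.sum_add_distrib, ← Finset.sum_add_distrib]
    exact Finset.sum_congr rfl fun i _ => by ring
  constructor
  · have key : F * (2 * e) ≤ firstFF A (stdb m 0) v ^ 2 - ∑ i ∈ s, firstFF A (stdb m i) v ^ 2 := by
      rcases (real_inner_self_nonneg (x := A v)).eq_or_lt with h0 | hpos
      · have hA0 : A v = 0 := inner_self_eq_zero.mp h0.symm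
        simp [hFdef, firstFF, hA0]
      · have hnorm (u : Fin m → ℝ) : ‖F • A u - firstFF A u v • A v‖ ^ 2 =
            F * (F * firstFF A u u - firstFF A u v ^ 2) := by
          rw [norm_sub_sq_real, ← real_inner_self_eq_norm_sq, ← real_inner_self_eq_norm_sq]
          simp only [real_inner_smul_left, real_inner_smul_right, hFdef, firstFF]
          ring
        have h := norm_sq_le_sum_norm_sq_of_unit_timelike s (v 0) v
          (F • A (stdb m 0) - firstFF A (stdb m 0) v • A v)
          (fun i => F • A (stdb m i) - firstFF A (stdb m i) v • A v) hv' (by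
            simp only [smul_sub, Finset.sum_sub_distrib, smul_smul, ← Finset.sum_smul]
            rw [sub_add_sub_comm, ← add_smul, ← hF]
            conv_lhs => arg 2; rw [hAv]
            simp only [smul_add, Finset.smul_sum, smul_smul, mul_comm F, sub_self])
        simp only [hnorm, ← Finset.mul_sum, Finset.sum_sub_distrib] at h
        have h' := le_of_mul_le_mul_left h hpos
        rw [he]
        linarith
    rw [hexpand]
    linear_combination key - 2 * e * hF - e ^ 2 * hv'
  · have h := norm_sq_le_sum_norm_sq_of_unit_timelike s (v 0) v
      (firstFF A (stdb m 0) v - F * v 0) (fun i => firstFF A (stdb m i) v + F * v i) hv' (by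
        simp only [smul_eq_mul, mul_add, Finset.sum_add_distrib]
        have : ∑ i ∈ s, v i * (F * v i) = F * ∑ i ∈ s, v i ^ 2 := by
          rw [Finset.mul_sum]
          exact Finset.sum_congr rfl fun i _ => by ring
        rw [this]
        linear_combination -hF - F * hv')
    simp only [Real.norm_eq_abs, sq_abs, hexpand] at h
    rw [hexpand]
    linear_combination h + 2 * (e - F) * hF + (e ^ 2 - F ^ 2) * hv'
end
end

section
/- Let P and F be positive semidefinite real symmetric n×n matrices and let v ∈ ℝⁿ. Then trace(P·F) · (vᵀ·F·v) ≥ vᵀ·(F·P·F)·v. -/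
open scoped InnerProductSpace
open Matrix

noncomputable section

open scoped MatrixOrder in
/-- Every positive semidefinite real matrix is of the form `Bᵀ * B`. -/
lemma Matrix.PosSemidef.exists_eq_transpose_mul_self {ι : Type*} [Fintype ι]
    {M : Matrix ι ι ℝ} (hM : M.PosSemidef) : ∃ B : Matrix ι ι ℝ, M = Bᵀ * B := by
  classical
  obtain ⟨B, hB⟩ := CStarAlgebra.nonneg_iff_eq_star_mul_self.mp hM.nonneg
  exact ⟨B, by simpa [star_eq_conjTranspose] using hB⟩

/-- The Cauchy–Schwarz inequality for the form defined by a positive semidefinite matrix. -/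
lemma Matrix.PosSemidef.dotProduct_mulVec_sq_le {ι : Type*} [Fintype ι]
    {M : Matrix ι ι ℝ} (hM : M.PosSemidef) (u v : ι → ℝ) :
    (u ⬝ᵥ M *ᵥ v) ^ 2 ≤ (u ⬝ᵥ M *ᵥ u) * (v ⬝ᵥ M *ᵥ v) := by
  obtain ⟨B, rfl⟩ := hM.exists_eq_transpose_mul_self
  have h (x y : ι → ℝ) : x ⬝ᵥ (Bᵀ * B) *ᵥ y = (B *ᵥ x) ⬝ᵥ (B *ᵥ y) := by
    rw [← mulVec_mulVec, dotProduct_mulVec, vecMul_transpose]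
  simp only [h]
  simpa only [dotProduct, sq] using
    Finset.sum_mul_sq_le_sq_mul_sq Finset.univ (B *ᵥ u) (B *ᵥ v)

/-- for positive semidefinite real symmetric matrices `P`, `F` and any
vector `v`, `trace(P·F) · (vᵀ F v) ≥ vᵀ (F·P·F) v`. -/
theorem stmt5 (n : ℕ) (P F : Matrix (Fin n) (Fin n) ℝ)
    (hP : P.PosSemidef) (hF : F.PosSemidef) (v : Fin n → ℝ) :
    (P * F).trace * (v ⬝ᵥ F.mulVec v) ≥ v ⬝ᵥ (F * P * F).mulVec v := by
  obtain ⟨A, rfl⟩ := hP.exists_eq_transpose_mul_self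
  have hFt : Fᵀ = F := by simpa using hF.isHermitian.eq
  have htrace : (Aᵀ * A * F).trace = ∑ k, A k ⬝ᵥ F *ᵥ A k := by
    rw [Matrix.mul_assoc, trace_mul_comm, Matrix.mul_assoc]
    rfl
  have hquad : v ⬝ᵥ (F * (Aᵀ * A) * F) *ᵥ v = ∑ k, (A k ⬝ᵥ F *ᵥ v) ^ 2 := by
    have h : F * (Aᵀ * A) * F = (A * F)ᵀ * (A * F) := by
      rw [transpose_mul, hFt]; simp only [Matrix.mul_assoc]
    rw [h, ← mulVec_mulVec, dotProduct_mulVec, vecMul_transpose, ← mulVec_mulVec]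
    simp only [dotProduct, sq, mulVec]
  rw [htrace, hquad, Finset.sum_mul]
  exact Finset.sum_le_sum fun k _ => hF.dotProduct_mulVec_sq_le (A k) v
end
end

section
/- Let m ≥ 3 and let η be the Minkowski bilinear form on ℝ^m. Let l, n ∈ ℝ^m satisfy η(l,l) = 0, η(n,n) = 0, and η(l,n) = 1. Then the symmetric bilinear form p defined by p(u,w) := η(u,l)·η(w,n) + η(u,n)·η(w,l) − η(u,w) is positive semidefinite, and p(l,u) = 0 and p(n,u) = 0 for all u ∈ ℝ^m. -/
open scoped InnerProductSpace

noncomputable section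

theorem mink_comm (m : ℕ) (u w : Fin m → ℝ) : mink m u w = mink m w u := by
  simp only [mink, mul_comm]

theorem mink_add_left (m : ℕ) (u v w : Fin m → ℝ) :
    mink m (u + v) w = mink m u w + mink m v w := by
  simp only [mink, ← Finset.sum_add_distrib, Pi.add_apply]
  refine Finset.sum_congr rfl fun i _ => ?_
  split_ifs <;> ring

theorem mink_smul_left (m : ℕ) (c : ℝ) (u w : Fin m → ℝ) :
    mink m (c • u) w = c * mink m u w := by
  simp only [mink, Finset.mul_sum, Pi.smul_apply, smul_eq_mul]
  refine Finset.sum_congr rfl fun i _ => ?_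
  split_ifs <;> ring

theorem mink_add_right (m : ℕ) (u v w : Fin m → ℝ) :
    mink m u (v + w) = mink m u v + mink m u w := by
  rw [mink_comm, mink_add_left, mink_comm m v, mink_comm m w]

theorem mink_smul_right (m : ℕ) (c : ℝ) (u w : Fin m → ℝ) :
    mink m u (c • w) = c * mink m u w := by
  rw [mink_comm, mink_smul_left, mink_comm]

theorem mink_succ (k : ℕ) (u w : Fin (k + 1) → ℝ) :
    mink (k + 1) u w = u 0 * w 0 - ∑ i : Fin k, u i.succ * w i.succ := by
  simp [mink, Fin.sum_univ_succ, sub_eq_add_neg]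

/-- A vector orthogonal to a timelike vector is not timelike. -/
theorem mink_self_nonpos_of_orthogonal (m : ℕ) (t v : Fin m → ℝ)
    (ht : 0 < mink m t t) (hvt : mink m v t = 0) : mink m v v ≤ 0 := by
  cases m with
  | zero => simp [mink]
  | succ k =>
    rw [mink_succ] at *
    have hcs := Finset.sum_mul_sq_le_sq_mul_sq Finset.univ
      (fun i : Fin k => v i.succ) (fun i => t i.succ)
    have hv : 0 ≤ ∑ i : Fin k, v i.succ ^ 2 := Finset.sum_nonneg fun i _ => sq_nonneg _
    have htt : 0 ≤ ∑ i : Fin k, t i.succ ^ 2 := Finset.sum_nonneg fun i _ => sq_nonneg _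
    simp only [← sq] at ht ⊢
    rw [← sub_eq_zero.mp hvt, mul_pow] at hcs
    have hpos : 0 < t 0 ^ 2 := by linarith
    have hle : v 0 ^ 2 * t 0 ^ 2 ≤ (∑ i : Fin k, v i.succ ^ 2) * t 0 ^ 2 :=
      hcs.trans (mul_le_mul_of_nonneg_left (by linarith) hv)
    linarith [le_of_mul_le_mul_right hle hpos]

/-- the projection tensor `p(u,w) = η(u,l)·η(w,n) + η(u,n)·η(w,l) - η(u,w)`
is positive semidefinite and is orthogonal to `l` and `n`. -/
theorem stmt7 (m : ℕ) (hm : 3 ≤ m) (l n : Fin m → ℝ)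
    (hll : mink m l l = 0) (hnn : mink m n n = 0) (hln : mink m l n = 1) :
    (∀ u : Fin m → ℝ,
        0 ≤ mink m u l * mink m u n + mink m u n * mink m u l - mink m u u) ∧
      (∀ u : Fin m → ℝ,
        mink m l l * mink m u n + mink m l n * mink m u l - mink m l u = 0) ∧
      (∀ u : Fin m → ℝ,
        mink m n l * mink m u n + mink m n n * mink m u l - mink m n u = 0) := by
  have hnl : mink m n l = 1 := by rw [mink_comm, hln]
  refine ⟨fun u => ?_, fun u => ?_, fun u => ?_⟩
  · have key := mink_self_nonpos_of_orthogonal m (l + n)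
      (u + ((-mink m u n) • l + (-mink m u l) • n))
    simp only [mink_add_left, mink_add_right, mink_smul_left, mink_smul_right, hll, hnn, hln,
      hnl, mink_comm m l u, mink_comm m n u] at key
    linarith [key (by norm_num) (by ring)]
  · rw [hll, hln, mink_comm m l u]
    ring
  · rw [hnl, hnn, mink_comm m n u]
    ring
end
end
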